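/- arXiv:2111.08612 — 2 statements merged into one kernel-verified Lean document; each statement's English description precedes it below -/
import Mathlib

section
/- Let R be a (possibly noncommutative) ring of characteristic 2, and write [a:b] = a·b + b·a. Let d₁, d₂, d₃, h₁, h₂ ∈ R satisfy: [d₁:d₂] = 0, [h₁:d₁] = 0, [d₁:d₃] + d₂² = 0, and [d₁:h₂] = [d₂:h₁]. Then [d₁ : [d₂:h₂] + [d₃:h₁]] = 0; that is, ad(d₁)([d₂:h₂] + [d₃:h₁]) = 0. -/
/-- In a ring of characteristic 2, if `[d₁:d₂] = 0`, `[h₁:d₁] = 0`, `[d₁:d₃] + d₂² = 0`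
and `[d₁:h₂] = [d₂:h₁]`, then `ad(d₁)([d₂:h₂] + [d₃:h₁]) = 0`. -/
theorem stmt5 {R : Type*} [Ring R] [CharP R 2] (d₁ d₂ d₃ h₁ h₂ : R)
    (h12 : d₁ * d₂ + d₂ * d₁ = 0)
    (hh1 : h₁ * d₁ + d₁ * h₁ = 0)
    (h13 : (d₁ * d₃ + d₃ * d₁) + d₂ * d₂ = 0)
    (hmix : d₁ * h₂ + h₂ * d₁ = d₂ * h₁ + h₁ * d₂) :
    d₁ * ((d₂ * h₂ + h₂ * d₂) + (d₃ * h₁ + h₁ * d₃)) +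
      ((d₂ * h₂ + h₂ * d₂) + (d₃ * h₁ + h₁ * d₃)) * d₁ = 0 := by
  have two : ∀ x : R, x + x = 0 := fun x => CharTwo.add_self_eq_zero x
  have ng : ∀ x : R, -x = x := fun x => neg_eq_of_add_eq_zero_left (two x)
  have e12 : d₁ * d₂ = d₂ * d₁ := by
    rw [eq_neg_of_add_eq_zero_left h12, ng]
  have e11 : d₁ * h₁ = h₁ * d₁ := by
    rw [eq_neg_of_add_eq_zero_right hh1, ng]
  have e13 : d₁ * d₃ = d₃ * d₁ + d₂ * d₂ := by
    rw [← ng (d₃ * d₁ + d₂ * d₂)]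
    exact eq_neg_of_add_eq_zero_left (by rw [← add_assoc]; exact h13)
  have em : d₁ * h₂ = h₂ * d₁ + (d₂ * h₁ + h₁ * d₂) := by
    rw [← hmix, add_comm (d₁ * h₂), ← add_assoc, two, zero_add]
  have a1 : d₁ * (d₂ * h₂) = d₂ * (h₂ * d₁ + (d₂ * h₁ + h₁ * d₂)) := by
    rw [← mul_assoc, e12, mul_assoc, em]
  have a2 : d₁ * (h₂ * d₂) = h₂ * (d₂ * d₁) + (d₂ * h₁ + h₁ * d₂) * d₂ := by
    rw [← mul_assoc, em, add_mul, mul_assoc, e12]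
  have a3 : d₁ * (d₃ * h₁) = d₃ * (h₁ * d₁) + d₂ * d₂ * h₁ := by
    rw [← mul_assoc, e13, add_mul, mul_assoc, e11]
  have a4 : d₁ * (h₁ * d₃) = h₁ * (d₃ * d₁ + d₂ * d₂) := by
    rw [← mul_assoc, e11, mul_assoc, e13]
  rw [mul_add, mul_add, mul_add, a1, a2, a3, a4]
  rw [← two (d₂ * h₂ * d₁ + h₂ * d₂ * d₁ + d₃ * h₁ * d₁ + h₁ * d₃ * d₁ +
    d₂ * d₂ * h₁ + d₂ * h₁ * d₂ + h₁ * d₂ * d₂)]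
  noncomm_ring
end

section
/- Let n ≥ 2, let t and s satisfy 2 ≤ t ≤ n and 2 ≤ s ≤ n, and let p ≥ 2n. Let R : Fin t → Fin s → Prop be a relation such that for every j there exists i with R i j. Let c : Finset (Fin t) → Finset (Fin s) → ZMod 2 satisfy: (degree rule for bidegree (n, p)) whenever c S T ≠ 0, one has (s − 2·|T| + n) − (t − 2·|S|) = p; and (filtration rule) whenever c S T ≠ 0, i ∈ S, and R i j, then j ∈ T. Then c Finset.univ T = 0 for every T. -/
/-- First claim of Case 3 of Theorem 3.4: for a connected `n`-dimensional configuration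
with `2 ≤ t, s ≤ n` starting and ending circles, a coefficient matrix of bidegree
`(n, p)` with `p ≥ 2n` satisfying the filtration rule vanishes on the product of all
starting circles. -/
theorem stmt13 (n : ℕ) (hn : 2 ≤ n) (t s : ℕ)
    (ht1 : 2 ≤ t) (ht2 : t ≤ n) (hs1 : 2 ≤ s) (hs2 : s ≤ n)
    (p : ℤ) (hp : 2 * (n : ℤ) ≤ p)
    (R : Fin t → Fin s → Prop) (hR : ∀ j, ∃ i, R i j)
    (c : Finset (Fin t) → Finset (Fin s) → ZMod 2)
    (hdeg : ∀ S T, c S T ≠ 0 →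
      (((s : ℤ) - 2 * T.card) + n) - ((t : ℤ) - 2 * S.card) = p)
    (hfilt : ∀ S T, c S T ≠ 0 → ∀ i ∈ S, ∀ j, R i j → j ∈ T) :
    ∀ T, c Finset.univ T = 0 := by
  intro T
  by_contra h
  have hT : T = Finset.univ := by
    ext j
    obtain ⟨i, hi⟩ := hR j
    simpa using hfilt _ _ h i (Finset.mem_univ i) j hi
  have hd := hdeg _ _ h
  subst hT
  simp only [Finset.card_univ, Fintype.card_fin] at hd
  omega
end
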